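/- arXiv:2406.17386 — 5 statements merged into one kernel-verified Lean document; each statement's English description precedes it below -/
import Mathlib

section
/- Let Y ⊆ ℝ^{d₂} be a nonempty closed convex set and let μ_g, L_g > 0. Let g : ℝ^{d₁} × ℝ^{d₂} → ℝ be such that for every x ∈ ℝ^{d₁} the function y ↦ g(x,y) is differentiable on ℝ^{d₂} and μ_g-strongly convex, and for every y ∈ ℝ^{d₂} the map x ↦ ∇_y g(x,y) is L_g-Lipschitz. For each x let y*(x) denote the unique minimizer of g(x,·) over Y. Then y* is (L_g/μ_g)-Lipschitz: ‖y*(x₁) − y*(x₂)‖ ≤ (L_g/μ_g)‖x₁ − x₂‖ for all x₁, x₂ ∈ ℝ^{d₁}. -/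
open Set

open scoped RealInnerProductSpace

/-- First-order lower bound for a convex function. -/
theorem ConvexOn.apply_sub_le_sub_of_hasFDerivAt {E : Type*} [NormedAddCommGroup E]
    [NormedSpace ℝ E] {s : Set E} {f : E → ℝ} {f' : E →L[ℝ] ℝ} {a b : E} (hf : ConvexOn ℝ s f)
    (ha : a ∈ s) (hb : b ∈ s) (hfa : HasFDerivAt f f' a) : f' (b - a) ≤ f b - f a := by
  have hconv := hf.comp_affineMap (AffineMap.lineMap a b : ℝ →ᵃ[ℝ] E)
  have hderiv : HasDerivAt (f ∘ (AffineMap.lineMap a b : ℝ →ᵃ[ℝ] E)) (f' (b - a)) 0 :=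
    HasFDerivAt.comp_hasDerivAt (0 : ℝ) (by simpa using hfa) AffineMap.hasDerivAt_lineMap
  simpa [slope_def_field] using
    hconv.le_slope_of_hasDerivAt (by simpa using ha) (by simpa using hb) zero_lt_one hderiv

section InnerProductSpace

variable {E : Type*} [NormedAddCommGroup E] [InnerProductSpace ℝ E] [CompleteSpace E]

/-- The gradient of a strongly convex function is strongly monotone. -/
theorem StrongConvexOn.mul_norm_sub_sq_le_inner_gradient_sub {s : Set E} {m : ℝ} {f : E → ℝ}
    {a b : E} (hf : StrongConvexOn s m f) (ha : a ∈ s) (hb : b ∈ s)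
    (hfa : DifferentiableAt ℝ f a) (hfb : DifferentiableAt ℝ f b) :
    m * ‖a - b‖ ^ 2 ≤ ⟪gradient f a - gradient f b, a - b⟫ := by
  have first_order : ∀ {x y : E}, x ∈ s → y ∈ s → DifferentiableAt ℝ f x →
      ⟪gradient f x, y - x⟫ - m * ⟪x, y - x⟫ ≤
        (f y - m / 2 * ‖y‖ ^ 2) - (f x - m / 2 * ‖x‖ ^ 2) := by
    intro x y hx hy hfx
    have h := (strongConvexOn_iff_convex.1 hf).apply_sub_le_sub_of_hasFDerivAt hx hy
      (hfx.hasGradientAt.hasFDerivAt.sub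
        ((hasStrictFDerivAt_norm_sq x).hasFDerivAt.const_mul (m / 2)))
    simp only [sub_apply, smul_apply, innerSL_apply_apply,
      InnerProductSpace.toDual_apply_apply, smul_eq_mul, nsmul_eq_mul, Nat.cast_ofNat] at h
    linarith
  have hab := first_order ha hb hfa
  have hba := first_order hb ha hfb
  have hnorm : ‖a - b‖ ^ 2 = ⟪a, a - b⟫ - ⟪b, a - b⟫ := by
    rw [← inner_sub_left, real_inner_self_eq_norm_sq]
  rw [← neg_sub a b, inner_neg_right, inner_neg_right] at hab
  rw [hnorm, inner_sub_left]
  linarith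

/-- First-order optimality condition on a convex set. -/
theorem IsMinOn.inner_gradient_sub_nonneg {s : Set E} {f : E → ℝ} {a b : E} (h : IsMinOn f s a)
    (hs : Convex ℝ s) (ha : a ∈ s) (hb : b ∈ s) (hf : DifferentiableAt ℝ f a) :
    0 ≤ ⟪gradient f a, b - a⟫ := by
  simpa using h.localize.hasFDerivWithinAt_nonneg hf.hasGradientAt.hasFDerivAt.hasFDerivWithinAt
    (sub_mem_posTangentConeAt_of_segment_subset (hs.segment_subset ha hb))

/-- The minimizers of two functions over a convex set, the first of which is strongly convex, are
no further apart than the gradients at the second minimizer, up to the convexity modulus. -/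
theorem StrongConvexOn.mul_norm_sub_le_norm_gradient_sub {s : Set E} {m : ℝ} {f g : E → ℝ}
    {a b : E} (hf : StrongConvexOn s m f) (ha : a ∈ s) (hb : b ∈ s)
    (hfa : DifferentiableAt ℝ f a) (hfb : DifferentiableAt ℝ f b) (hgb : DifferentiableAt ℝ g b)
    (hmin_f : IsMinOn f s a) (hmin_g : IsMinOn g s b) :
    m * ‖a - b‖ ≤ ‖gradient f b - gradient g b‖ := by
  rcases eq_or_ne a b with rfl | hab
  · simp
  have hopt_f := hmin_f.inner_gradient_sub_nonneg hf.1 ha hb hfa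
  have hopt_g := hmin_g.inner_gradient_sub_nonneg hf.1 hb ha hgb
  have hmono := hf.mul_norm_sub_sq_le_inner_gradient_sub ha hb hfa hfb
  have hcs := real_inner_le_norm (gradient g b - gradient f b) (a - b)
  rw [norm_sub_rev (gradient g b)] at hcs
  rw [← neg_sub a b, inner_neg_right] at hopt_f
  rw [inner_sub_left] at hmono hcs
  refine le_of_mul_le_mul_right ?_ (norm_sub_pos_iff.2 hab)
  linarith

end InnerProductSpace

/-- For a lower-level objective `g` that is differentiable and
`μg`-strongly convex in `y`, with `∇_y g` being `Lg`-Lipschitz in `x`, the minimizer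
`y*(x)` of `g(x, ·)` over the nonempty closed convex set `Y` is `(Lg/μg)`-Lipschitz. -/
theorem lower_level_minimizer_lipschitz {d₁ d₂ : ℕ}
    (Y : Set (EuclideanSpace ℝ (Fin d₂))) (hYne : Y.Nonempty) (hYclosed : IsClosed Y)
    (hYconv : Convex ℝ Y)
    (μg Lg : ℝ) (hμg : 0 < μg) (hLg : 0 < Lg)
    (g : EuclideanSpace ℝ (Fin d₁) → EuclideanSpace ℝ (Fin d₂) → ℝ)
    (hdiff : ∀ x, Differentiable ℝ (g x))
    (hsc : ∀ x, ConvexOn ℝ univ (fun y => g x y - μg / 2 * ‖y‖ ^ 2))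
    (hlip : ∀ y x₁ x₂, ‖gradient (g x₁) y - gradient (g x₂) y‖ ≤ Lg * ‖x₁ - x₂‖)
    (ystar : EuclideanSpace ℝ (Fin d₁) → EuclideanSpace ℝ (Fin d₂))
    (hystar : ∀ x, ystar x ∈ Y ∧ ∀ y ∈ Y, g x (ystar x) ≤ g x y) :
    ∀ x₁ x₂, ‖ystar x₁ - ystar x₂‖ ≤ (Lg / μg) * ‖x₁ - x₂‖ := by
  intro x₁ x₂
  have h := (strongConvexOn_iff_convex.2
    ((hsc x₁).subset (subset_univ Y) hYconv)).mul_norm_sub_le_norm_gradient_sub (hystar x₁).1 (hystar x₂).1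
    (hdiff x₁ _) (hdiff x₁ _) (hdiff x₂ _)
    (isMinOn_iff.2 (hystar x₁).2) (isMinOn_iff.2 (hystar x₂).2)
  rw [div_mul_eq_mul_div, le_div_iff₀' hμg]
  exact h.trans (hlip _ x₁ x₂)
end

section
/- Fix x ∈ ℝ^{d₁}, constants η, μ_g, L_f, L_g, L_gxy, L_gyy, C_fy, C_gxy, K_J > 0 with ημ_g < 1. Let G_x, G_y : ℝ^{d₂} → (ℝ^{d₁} resp. ℝ^{d₂}) be maps (standing for y ↦ ∇_x f(x,y) and y ↦ ∇_y f(x,y)) that are L_f-Lipschitz, with ‖G_y(y)‖ ≤ C_fy for all y. Let B : ℝ^{d₂} → L(ℝ^{d₂}, ℝ^{d₁}) (standing for y ↦ ∇²_{xy}g(x,y)) be L_gxy-Lipschitz with ‖B(y)‖ ≤ C_gxy for all y; let S : ℝ^{d₂} → L(ℝ^{d₂}, ℝ^{d₂}) (standing for y ↦ ∇²_{yy}g(x,y)) be L_gyy-Lipschitz with ‖I − ηS(y)‖ ≤ 1 − ημ_g for all y; let h : ℝ^{d₂} → ℝ^{d₂} (standing for y ↦ ∇_y g(x,y)) be L_g-Lipschitz;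 and let J : ℝ^{d₂} → L(ℝ^{d₂}, ℝ^{d₂}) (standing for the Jacobian of the smoothed projection) satisfy ‖J(z)‖ ≤ 1 for all z and be K_J-Lipschitz. Define z(y) = y − η·h(y) and Φ(y) = G_x(y) − η·B(y)∘J(z(y))ᵀ∘[I − (I − ηS(y))∘J(z(y))ᵀ]^{-1} G_y(y). Then Φ is L₁-Lipschitz with L₁ = L_f + L_gxy·C_fy/μ_g + (C_gxy·C_fy/μ_g)·(K_J + η·K_J·L_g) + C_gxy·C_fy·((1/(η·μ_g²))·(K_J + η·K_J·L_g)·(1 − ημ_g) + L_gyy/μ_g²) + (C_gxy/μ_g)·L_f. -/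
open ContinuousLinearMap

section

variable {E F : Type*} [NormedAddCommGroup E] [NormedSpace ℝ E]
  [NormedAddCommGroup F] [NormedSpace ℝ F]

theorem norm_ringInverse_one_sub_le [CompleteSpace E] {t : E →L[ℝ] E} {c : ℝ} (hc : 0 < c)
    (ht : ‖t‖ ≤ 1 - c) : ‖Ring.inverse (1 - t)‖ ≤ 1 / c := by
  have hu : IsUnit (1 - t) := isUnit_one_sub_of_norm_lt_one (by linarith)
  have hM : Ring.inverse (1 - t) = 1 + Ring.inverse (1 - t) * t := by
    have := Ring.inverse_mul_cancel _ hu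
    rw [mul_sub, mul_one] at this
    exact sub_eq_iff_eq_add.mp this
  have h1 : ‖(1 : E →L[ℝ] E)‖ ≤ 1 := norm_id_le
  have h2 : ‖Ring.inverse (1 - t)‖ ≤ 1 + ‖Ring.inverse (1 - t)‖ * (1 - c) := by
    calc ‖Ring.inverse (1 - t)‖ = ‖1 + Ring.inverse (1 - t) * t‖ := by rw [← hM]
      _ ≤ ‖(1 : E →L[ℝ] E)‖ + ‖Ring.inverse (1 - t)‖ * ‖t‖ :=
        (norm_add_le _ _).trans (by gcongr; exact norm_mul_le _ _)
      _ ≤ _ := by gcongr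
  rw [le_div_iff₀ hc]
  linarith

theorem norm_ringInverse_one_sub_sub_le [CompleteSpace E] {s t : E →L[ℝ] E} {c : ℝ} (hc : 0 < c)
    (hs : ‖s‖ ≤ 1 - c) (ht : ‖t‖ ≤ 1 - c) :
    ‖Ring.inverse (1 - s) - Ring.inverse (1 - t)‖ ≤ 1 / c * ‖s - t‖ * (1 / c) := by
  have hus : IsUnit (1 - s) := isUnit_one_sub_of_norm_lt_one (by linarith)
  have hut : IsUnit (1 - t) := isUnit_one_sub_of_norm_lt_one (by linarith)
  have key : Ring.inverse (1 - s) - Ring.inverse (1 - t) =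
      Ring.inverse (1 - s) * (s - t) * Ring.inverse (1 - t) := by
    have h : s - t = (1 - t) - (1 - s) := by abel
    rw [h, mul_sub, sub_mul, Ring.inverse_mul_cancel _ hus, mul_assoc,
      Ring.mul_inverse_cancel _ hut, mul_one, one_mul]
  rw [key]
  refine (norm_mul_le _ _).trans ?_
  gcongr
  · exact (norm_mul_le _ _).trans (by gcongr; exact norm_ringInverse_one_sub_le hc hs)
  · exact norm_ringInverse_one_sub_le hc ht

theorem norm_apply_sub_apply_le (A₁ A₂ : E →L[ℝ] F) (v₁ v₂ : E) :
    ‖A₁ v₁ - A₂ v₂‖ ≤ ‖A₁ - A₂‖ * ‖v₁‖ + ‖A₂‖ * ‖v₁ - v₂‖ := by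
  have h : A₁ v₁ - A₂ v₂ = (A₁ - A₂) v₁ + A₂ (v₁ - v₂) := by simp
  rw [h]
  exact (norm_add_le _ _).trans (add_le_add (le_opNorm _ _) (le_opNorm _ _))

theorem norm_mul_sub_mul_le (A₁ A₂ T₁ T₂ : E →L[ℝ] E) :
    ‖A₁ * T₁ - A₂ * T₂‖ ≤ ‖A₁ - A₂‖ * ‖T₁‖ + ‖A₂‖ * ‖T₁ - T₂‖ := by
  have h : A₁ * T₁ - A₂ * T₂ = (A₁ - A₂) * T₁ + A₂ * (T₁ - T₂) := by noncomm_ring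
  rw [h]
  exact (norm_add_le _ _).trans (add_le_add (norm_mul_le _ _) (norm_mul_le _ _))

end

/-- Lipschitz continuity in `y` of the smoothed hypergradient surrogate
`Φ(y) = G_x(y) − η·B(y)∘J(z(y))ᵀ∘[I − (I − ηS(y))∘J(z(y))ᵀ]⁻¹ G_y(y)`,
where `z(y) = y − η·h(y)`. -/
theorem hypergradient_surrogate_lipschitz_in_y {d₁ d₂ : ℕ}
    (η μg Lf Lg Lgxy Lgyy Cfy Cgxy KJ : ℝ)
    (hη : 0 < η) (hμg : 0 < μg) (hLf : 0 < Lf) (hLg : 0 < Lg) (hLgxy : 0 < Lgxy)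
    (hLgyy : 0 < Lgyy) (hCfy : 0 < Cfy) (hCgxy : 0 < Cgxy) (hKJ : 0 < KJ)
    (hημ : η * μg < 1)
    (Gx : EuclideanSpace ℝ (Fin d₂) → EuclideanSpace ℝ (Fin d₁))
    (Gy : EuclideanSpace ℝ (Fin d₂) → EuclideanSpace ℝ (Fin d₂))
    (B : EuclideanSpace ℝ (Fin d₂) →
      (EuclideanSpace ℝ (Fin d₂) →L[ℝ] EuclideanSpace ℝ (Fin d₁)))
    (S : EuclideanSpace ℝ (Fin d₂) →
      (EuclideanSpace ℝ (Fin d₂) →L[ℝ] EuclideanSpace ℝ (Fin d₂)))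
    (h : EuclideanSpace ℝ (Fin d₂) → EuclideanSpace ℝ (Fin d₂))
    (J : EuclideanSpace ℝ (Fin d₂) →
      (EuclideanSpace ℝ (Fin d₂) →L[ℝ] EuclideanSpace ℝ (Fin d₂)))
    (hGx : ∀ y₁ y₂, ‖Gx y₁ - Gx y₂‖ ≤ Lf * ‖y₁ - y₂‖)
    (hGy : ∀ y₁ y₂, ‖Gy y₁ - Gy y₂‖ ≤ Lf * ‖y₁ - y₂‖)
    (hGyb : ∀ y, ‖Gy y‖ ≤ Cfy)
    (hB : ∀ y₁ y₂, ‖B y₁ - B y₂‖ ≤ Lgxy * ‖y₁ - y₂‖)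
    (hBb : ∀ y, ‖B y‖ ≤ Cgxy)
    (hS : ∀ y₁ y₂, ‖S y₁ - S y₂‖ ≤ Lgyy * ‖y₁ - y₂‖)
    (hSb : ∀ y, ‖1 - η • S y‖ ≤ 1 - η * μg)
    (hh : ∀ y₁ y₂, ‖h y₁ - h y₂‖ ≤ Lg * ‖y₁ - y₂‖)
    (hJb : ∀ z, ‖J z‖ ≤ 1)
    (hJ : ∀ z₁ z₂, ‖J z₁ - J z₂‖ ≤ KJ * ‖z₁ - z₂‖) :
    ∀ y₁ y₂ : EuclideanSpace ℝ (Fin d₂),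
      ‖(Gx y₁ - η • (((B y₁) ∘L (adjoint (J (y₁ - η • h y₁))) ∘L
          Ring.inverse (1 - (1 - η • S y₁) ∘L adjoint (J (y₁ - η • h y₁)))) (Gy y₁))) -
        (Gx y₂ - η • (((B y₂) ∘L (adjoint (J (y₂ - η • h y₂))) ∘L
          Ring.inverse (1 - (1 - η • S y₂) ∘L adjoint (J (y₂ - η • h y₂)))) (Gy y₂)))‖ ≤
      (Lf + Lgxy * Cfy / μg + (Cgxy * Cfy / μg) * (KJ + η * KJ * Lg) +
        Cgxy * Cfy * ((1 / (η * μg ^ 2)) * (KJ + η * KJ * Lg) * (1 - η * μg) +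
          Lgyy / μg ^ 2) + (Cgxy / μg) * Lf) * ‖y₁ - y₂‖ := by
  intro y₁ y₂
  set D := ‖y₁ - y₂‖ with hD
  have hD0 : 0 ≤ D := norm_nonneg _
  have hc : 0 < η * μg := mul_pos hη hμg
  have hc' : 0 ≤ 1 - η * μg := by linarith
  have hz : ‖(y₁ - η • h y₁) - (y₂ - η • h y₂)‖ ≤ (1 + η * Lg) * D := by
    have e : (y₁ - η • h y₁) - (y₂ - η • h y₂) = (y₁ - y₂) - η • (h y₁ - h y₂) := by module
    have hs := norm_sub_le (y₁ - y₂) (η • (h y₁ - h y₂))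
    rw [norm_smul, Real.norm_of_nonneg hη.le] at hs
    have := mul_le_mul_of_nonneg_left (hh y₁ y₂) hη.le
    rw [e]
    linarith
  have hTb (y) : ‖adjoint (J (y - η • h y))‖ ≤ 1 := by
    rw [LinearIsometryEquiv.norm_map]
    exact hJb _
  have hT : ‖adjoint (J (y₁ - η • h y₁)) - adjoint (J (y₂ - η • h y₂))‖ ≤
      (KJ + η * KJ * Lg) * D := by
    rw [← map_sub, LinearIsometryEquiv.norm_map]
    have := mul_le_mul_of_nonneg_left hz hKJ.le
    linarith [hJ (y₁ - η • h y₁) (y₂ - η • h y₂)]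
  simp only [comp_apply]
  have hT₁ := hTb y₁
  have hT₂ := hTb y₂
  generalize adjoint (J (y₁ - η • h y₁)) = T₁ at hT hT₁ ⊢
  generalize adjoint (J (y₂ - η • h y₂)) = T₂ at hT hT₂ ⊢
  have contraction {y} {T : EuclideanSpace ℝ (Fin d₂) →L[ℝ] EuclideanSpace ℝ (Fin d₂)}
      (hT : ‖T‖ ≤ 1) : ‖(1 - η • S y) ∘L T‖ ≤ 1 - η * μg :=
    (opNorm_comp_le _ _).trans
      ((mul_le_of_le_one_right (norm_nonneg _) hT).trans (hSb y))
  have hst : ‖(1 - η • S y₁) ∘L T₁ - (1 - η • S y₂) ∘L T₂‖ ≤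
      η * (Lgyy * D) * 1 + (1 - η * μg) * ((KJ + η * KJ * Lg) * D) := by
    refine (norm_mul_sub_mul_le (1 - η • S y₁) (1 - η • S y₂) T₁ T₂).trans ?_
    have e : (1 - η • S y₁) - (1 - η • S y₂) = η • (S y₂ - S y₁) := by module
    rw [e, norm_smul, Real.norm_of_nonneg hη.le, norm_sub_rev (S y₂)]
    gcongr
    · exact hS _ _
    · exact hSb _
  have hM₁ := norm_ringInverse_one_sub_le hc (contraction (y := y₁) hT₁)
  have hM₂ := norm_ringInverse_one_sub_le hc (contraction (y := y₂) hT₂)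
  have hM := norm_ringInverse_one_sub_sub_le hc (contraction (y := y₁) hT₁)
    (contraction (y := y₂) hT₂)
  generalize Ring.inverse (1 - (1 - η • S y₁) ∘L T₁) = M₁ at hM hM₁ ⊢
  generalize Ring.inverse (1 - (1 - η • S y₂) ∘L T₂) = M₂ at hM hM₂ ⊢
  have hMG₁ : ‖M₁ (Gy y₁)‖ ≤ 1 / (η * μg) * Cfy := le_of_opNorm_le_of_le _ hM₁ (hGyb y₁)
  have hTMG₁ : ‖T₁ (M₁ (Gy y₁))‖ ≤ 1 * (1 / (η * μg) * Cfy) := le_of_opNorm_le_of_le _ hT₁ hMG₁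
  set δM := 1 / (η * μg) *
    (η * (Lgyy * D) * 1 + (1 - η * μg) * ((KJ + η * KJ * Lg) * D)) * (1 / (η * μg)) with hδM
  have hMG : ‖M₁ (Gy y₁) - M₂ (Gy y₂)‖ ≤ δM * Cfy + 1 / (η * μg) * (Lf * D) := by
    refine (norm_apply_sub_apply_le _ _ _ _).trans ?_
    gcongr
    · exact hM.trans (by rw [hδM]; gcongr)
    · exact hGyb _
    · exact hGy _ _
  have hTMG : ‖T₁ (M₁ (Gy y₁)) - T₂ (M₂ (Gy y₂))‖ ≤
      (KJ + η * KJ * Lg) * D * (1 / (η * μg) * Cfy) +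
        1 * (δM * Cfy + 1 / (η * μg) * (Lf * D)) := by
    refine (norm_apply_sub_apply_le _ _ _ _).trans ?_
    gcongr
  have hBTMG : ‖B y₁ (T₁ (M₁ (Gy y₁))) - B y₂ (T₂ (M₂ (Gy y₂)))‖ ≤
      Lgxy * D * (1 * (1 / (η * μg) * Cfy)) +
        Cgxy * ((KJ + η * KJ * Lg) * D * (1 / (η * μg) * Cfy) +
          1 * (δM * Cfy + 1 / (η * μg) * (Lf * D))) := by
    refine (norm_apply_sub_apply_le _ _ _ _).trans ?_
    gcongr
    · exact hB _ _
    · exact hBb _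
  rw [sub_sub_sub_comm, ← smul_sub]
  refine (norm_sub_le _ _).trans ?_
  rw [norm_smul, Real.norm_of_nonneg hη.le]
  refine (add_le_add (hGx y₁ y₂) (mul_le_mul_of_nonneg_left hBTMG hη.le)).trans_eq ?_
  rw [hδM, ← hD]
  field_simp
  ring
end

section
/- Let P : ℝ^d → ℝ^d be 1-Lipschitz and δ > 0, and let P_δ be the randomized smoothing of P. Then P_δ is differentiable at every z ∈ ℝ^d, and its Jacobian satisfies DP_δ(z) = (d/(2δ)) · E_w[(P(z + δw) − P(z − δw)) wᵀ], where w is distributed according to the uniform probability measure on the unit Euclidean sphere of ℝ^d and (P(z+δw) − P(z−δw))wᵀ denotes the rank-one d×d matrix (outer product). -/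
open MeasureTheory Metric ContinuousLinearMap

/-- The uniform probability measure on the closed unit Euclidean ball of `ℝ^d`. -/
noncomputable def uniformUnitBall (d : ℕ) : Measure (EuclideanSpace ℝ (Fin d)) :=
  (volume (closedBall (0 : EuclideanSpace ℝ (Fin d)) 1))⁻¹ •
    volume.restrict (closedBall (0 : EuclideanSpace ℝ (Fin d)) 1)

/-- The randomized smoothing `P_δ(z) = E_u[P(z + δu)]`, with `u` uniform on the
closed unit Euclidean ball. -/
noncomputable def randomizedSmoothing {d : ℕ}
    (P : EuclideanSpace ℝ (Fin d) → EuclideanSpace ℝ (Fin d)) (δ : ℝ)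
    (z : EuclideanSpace ℝ (Fin d)) : EuclideanSpace ℝ (Fin d) :=
  ∫ u, P (z + δ • u) ∂(uniformUnitBall d)

/-- The uniform probability measure on the unit Euclidean sphere of `ℝ^d`. -/
noncomputable def uniformUnitSphere (d : ℕ) :
    Measure (sphere (0 : EuclideanSpace ℝ (Fin d)) 1) :=
  ((volume : Measure (EuclideanSpace ℝ (Fin d))).toSphere Set.univ)⁻¹ •
    (volume : Measure (EuclideanSpace ℝ (Fin d))).toSphere

section BallDivergence

open Set Module

variable {E : Type*} [NormedAddCommGroup E]

theorem hasDerivAt_norm_add_smul [InnerProductSpace ℝ E] {x : E} (hx : x ≠ 0) (v : E) :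
    HasDerivAt (fun t : ℝ ↦ ‖x + t • v‖) (inner ℝ x v / ‖x‖) 0 := by
  have h1 : HasDerivAt (fun t : ℝ ↦ x + t • v) v 0 := by
    simpa using ((hasDerivAt_id (0 : ℝ)).smul_const v).const_add x
  have h2 := h1.norm_sq.sqrt (by simpa using hx)
  simp only [Real.sqrt_sq (norm_nonneg _), zero_smul, add_zero] at h2
  convert h2 using 1
  rw [mul_div_mul_left _ _ two_ne_zero]

theorem lineDeriv_max_sub_norm_neg [InnerProductSpace ℝ E] {x : E} (hx : x ≠ 0) {R : ℝ}
    (hR : ‖x‖ ≠ R) (v : E) :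
    lineDeriv ℝ (fun y : E ↦ max (R - ‖y‖) 0) x (-v) =
      (ball (0 : E) R).indicator (fun y ↦ inner ℝ y v / ‖y‖) x := by
  have hcont : Continuous fun t : ℝ ↦ ‖x + t • (-v)‖ := by fun_prop
  rcases lt_or_gt_of_ne hR with h | h
  · rw [indicator_of_mem (by simpa using h)]
    have hd := (hasDerivAt_norm_add_smul hx (-v)).const_sub R
    have : HasDerivAt (fun t : ℝ ↦ max (R - ‖x + t • (-v)‖) 0) (-(inner ℝ x (-v) / ‖x‖)) 0 := by
      refine hd.congr_of_eventuallyEq ?_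
      filter_upwards [hcont.continuousAt.eventually_lt (continuousAt_const (y := R))
        (by simpa using h)] with t ht
      exact max_eq_left (by linarith)
    rw [lineDeriv, this.deriv, inner_neg_right, neg_div, neg_neg]
  · rw [indicator_of_notMem (by simpa using h.le)]
    have : HasDerivAt (fun t : ℝ ↦ max (R - ‖x + t • (-v)‖) 0) 0 0 := by
      refine (hasDerivAt_const (0 : ℝ) (0 : ℝ)).congr_of_eventuallyEq ?_
      filter_upwards [(continuousAt_const (y := R)).eventually_lt hcont.continuousAt
        (by simpa using h)] with t ht
      exact max_eq_right (by linarith)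
    exact this.deriv

theorem lipschitzWith_max_sub_norm (R : ℝ) :
    LipschitzWith 1 fun y : E ↦ max (R - ‖y‖) 0 := by
  refine LipschitzWith.max_const (LipschitzWith.of_dist_le_mul fun x y ↦ ?_) 0
  simpa [dist_eq_norm, abs_sub_comm] using abs_norm_sub_norm_le x y

theorem hasDerivAt_max_sub_const {a R : ℝ} (h : a ≠ R) :
    HasDerivAt (fun r : ℝ ↦ max (r - a) 0) (if a < R then 1 else 0) R := by
  rcases lt_or_gt_of_ne h with h | h
  · rw [if_pos h]
    refine ((hasDerivAt_id R).sub_const a).congr_of_eventuallyEq ?_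
    filter_upwards [lt_mem_nhds h] with r hr
    exact max_eq_left (by simpa using hr.le)
  · rw [if_neg h.not_gt]
    refine (hasDerivAt_const R (0 : ℝ)).congr_of_eventuallyEq ?_
    filter_upwards [gt_mem_nhds h] with r hr
    exact max_eq_right (by linarith)

variable [MeasurableSpace E] [BorelSpace E]

theorem integral_eq_integral_Ioi_integral_sphere [NormedSpace ℝ E] [FiniteDimensional ℝ E]
    [Nontrivial E] (μ : Measure E) [μ.IsAddHaarMeasure] {g : E → ℝ} (hg : Integrable g μ) :
    ∫ x, g x ∂μ = ∫ r in Ioi (0 : ℝ), r ^ (finrank ℝ E - 1) *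
      ∫ w : sphere (0 : E) 1, g (r • (w : E)) ∂μ.toSphere := by
  have hmp := μ.measurePreserving_homeomorphUnitSphereProd
  have hemb := (homeomorphUnitSphereProd E).measurableEmbedding
  let G : sphere (0 : E) 1 × Ioi (0 : ℝ) → ℝ := fun p ↦ g ((p.2 : ℝ) • (p.1 : E))
  have hcomp : ∀ x : ({0}ᶜ : Set E), G (homeomorphUnitSphereProd E x) = g x := by
    intro x
    have hx : ‖(x : E)‖ ≠ 0 := norm_ne_zero_iff.2 x.2
    simp [G, smul_smul, hx]
  have hG : Integrable G (μ.toSphere.prod (.volumeIoiPow (finrank ℝ E - 1))) := by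
    rw [← hmp.integrable_comp_emb hemb]
    have : G ∘ homeomorphUnitSphereProd E = g ∘ (↑) := funext hcomp
    rw [this, ← integrableOn_iff_comap_subtypeVal (measurableSet_singleton _).compl]
    exact hg.integrableOn
  calc
    ∫ x, g x ∂μ = ∫ x : ({0}ᶜ : Set E), g x ∂(μ.comap (↑)) := by
      rw [integral_subtype_comap (measurableSet_singleton _).compl g,
        restrict_compl_singleton]
    _ = ∫ p, G p ∂μ.toSphere.prod (.volumeIoiPow (finrank ℝ E - 1)) := by
      rw [← hmp.integral_comp hemb]
      simp only [hcomp]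
    _ = ∫ r : Ioi (0 : ℝ), ∫ w, G (w, r) ∂μ.toSphere ∂.volumeIoiPow (finrank ℝ E - 1) :=
      integral_prod_symm G hG
    _ = _ := by
      simp only [Measure.volumeIoiPow, ENNReal.ofReal, G]
      rw [integral_withDensity_eq_integral_smul,
        integral_subtype_comap measurableSet_Ioi fun r : ℝ ↦ Real.toNNReal (r ^ (finrank ℝ E - 1)) •
          ∫ w : sphere (0 : E) 1, g (r • (w : E)) ∂μ.toSphere,
        setIntegral_congr_fun measurableSet_Ioi fun x hx ↦ ?_]
      · simp only [NNReal.smul_def, Real.coe_toNNReal _ (pow_nonneg (mem_Ioi.1 hx).le _),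
          smul_eq_mul]
      · exact (measurable_subtype_coe.pow_const _).real_toNNReal

variable [InnerProductSpace ℝ E] [FiniteDimensional ℝ E]
  (μ : Measure E) [μ.IsAddHaarMeasure]

theorem ae_norm_ne [Nontrivial E] (R : ℝ) : ∀ᵐ x ∂μ, ‖x‖ ≠ R := by
  have h : μ (sphere (0 : E) R) = 0 := Measure.addHaar_sphere μ 0 R
  filter_upwards [measure_eq_zero_iff_ae_notMem.1 h] with x hx
  simpa using hx

theorem continuous_integral_sphere_smul {f : E → ℝ} (hf : Continuous f) (v : E) :
    Continuous fun r : ℝ ↦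
      ∫ w : sphere (0 : E) 1, f (r • (w : E)) * inner ℝ (w : E) v ∂μ.toSphere := by
  have := continuous_parametric_integral_of_continuous (μ := μ.toSphere)
    (f := fun (r : ℝ) (w : sphere (0 : E) 1) ↦ f (r • (w : E)) * inner ℝ (w : E) v)
    (by fun_prop) isCompact_univ
  simpa using this

/-- Divergence theorem on a ball, tested against a cone: both sides are integrals in `r` from `0`
to `R` of the corresponding quantities for the ball of radius `r`. -/
theorem integral_lineDeriv_mul_max_sub_norm [Nontrivial E] {f : E → ℝ} {C : NNReal}
    (hf : LipschitzWith C f) (v : E) {R : ℝ} (hR : 0 < R) :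
    ∫ x, lineDeriv ℝ f x v * max (R - ‖x‖) 0 ∂μ =
      ∫ r in (0 : ℝ)..R, r ^ (finrank ℝ E - 1) *
        ∫ w : sphere (0 : E) 1, f (r • (w : E)) * inner ℝ (w : E) v ∂μ.toSphere := by
  have hsupp : HasCompactSupport fun y : E ↦ max (R - ‖y‖) 0 := by
    refine HasCompactSupport.intro (isCompact_closedBall 0 R) fun x hx ↦ max_eq_right ?_
    have : R < ‖x‖ := by simpa using hx
    linarith
  rw [LipschitzWith.integral_lineDeriv_mul_eq hf (lipschitzWith_max_sub_norm R) hsupp v]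
  let g : E → ℝ := (ball (0 : E) R).indicator fun y ↦ inner ℝ y v / ‖y‖ * f y
  have hg : Integrable g μ := by
    rw [integrable_indicator_iff measurableSet_ball]
    have hfi : IntegrableOn f (ball 0 R) μ :=
      (hf.continuous.continuousOn.integrableOn_compact (isCompact_closedBall 0 R)).mono_set
        ball_subset_closedBall
    refine Integrable.bdd_mul (c := ‖v‖) hfi ?_ (.of_forall fun y ↦ ?_)
    · exact (Measurable.div (by fun_prop) measurable_norm).aestronglyMeasurable
    · rw [norm_div, norm_norm]
      refine div_le_of_le_mul₀ (norm_nonneg _) (norm_nonneg _) ?_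
      rw [mul_comm]
      exact norm_inner_le_norm y v
  have hae : (fun x ↦ lineDeriv ℝ (fun y : E ↦ max (R - ‖y‖) 0) x (-v) * f x) =ᵐ[μ] g := by
    filter_upwards [ae_norm_ne μ R, ae_norm_ne μ 0] with x hx hx0
    rw [lineDeriv_max_sub_norm_neg (by simpa using hx0) hx, ← indicator_mul_left]
  rw [integral_congr_ae hae, integral_eq_integral_Ioi_integral_sphere μ hg,
    intervalIntegral.integral_of_le hR.le, integral_Ioc_eq_integral_Ioo, ← Ioi_inter_Iio,
    ← setIntegral_indicator measurableSet_Iio]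
  refine setIntegral_congr_fun measurableSet_Ioi fun r (hr : 0 < r) ↦ ?_
  have hmem (w : sphere (0 : E) 1) : r • (w : E) ∈ ball (0 : E) R ↔ r < R := by
    simp [norm_smul, abs_of_pos hr]
  by_cases hrR : r < R
  · rw [indicator_of_mem (mem_Iio.2 hrR)]
    congr 2 with w
    simp only [g]
    rw [indicator_of_mem ((hmem w).2 hrR), real_inner_smul_left, norm_smul, Real.norm_of_nonneg hr.le,
      norm_eq_of_mem_sphere, mul_one, mul_div_cancel_left₀ _ hr.ne', mul_comm]
  · rw [indicator_of_notMem (by simpa using hrR)]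
    have hzero (w : sphere (0 : E) 1) : g (r • (w : E)) = 0 :=
      indicator_of_notMem (by rwa [hmem w]) _
    simp [hzero]

theorem integral_ball_lineDeriv_eq_integral_sphere [Nontrivial E] {f : E → ℝ} {C : NNReal}
    (hf : LipschitzWith C f) (v : E) :
    ∫ x in ball (0 : E) 1, lineDeriv ℝ f x v ∂μ =
      ∫ w : sphere (0 : E) 1, f w * inner ℝ (w : E) v ∂μ.toSphere := by
  let A : ℝ → ℝ := fun R ↦ ∫ x in ball (0 : E) 2, lineDeriv ℝ f x v * max (R - ‖x‖) 0 ∂μ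
  have hΦ : Continuous fun r : ℝ ↦ r ^ (finrank ℝ E - 1) *
      ∫ w : sphere (0 : E) 1, f (r • (w : E)) * inner ℝ (w : E) v ∂μ.toSphere :=
    (continuous_pow _).mul (continuous_integral_sphere_smul μ hf.continuous v)
  have hsphere : HasDerivAt A
      (∫ w : sphere (0 : E) 1, f w * inner ℝ (w : E) v ∂μ.toSphere) 1 := by
    have h := intervalIntegral.integral_hasDerivAt_right (hΦ.intervalIntegrable 0 1)
      hΦ.aestronglyMeasurable.stronglyMeasurableAtFilter hΦ.continuousAt
    simp only [one_pow, one_mul, one_smul] at h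
    refine h.congr_of_eventuallyEq ?_
    filter_upwards [Ioo_mem_nhds one_pos one_lt_two] with R hR
    rw [← integral_lineDeriv_mul_max_sub_norm μ hf v hR.1]
    refine setIntegral_eq_integral_of_forall_compl_eq_zero fun x hx ↦ ?_
    have : 2 ≤ ‖x‖ := by simpa using hx
    rw [max_eq_right (by linarith [hR.2]), mul_zero]
  have hmeas : AEStronglyMeasurable (fun x ↦ lineDeriv ℝ f x v) (μ.restrict (ball 0 2)) :=
    aestronglyMeasurable_lineDeriv hf.continuous _
  have hbound (x : E) : ‖lineDeriv ℝ f x v‖ ≤ C * ‖v‖ := norm_lineDeriv_le_of_lipschitz ℝ hf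
  have : IsFiniteMeasure (μ.restrict (ball (0 : E) 2)) :=
    isFiniteMeasure_restrict.2 measure_ball_lt_top.ne
  have hmax (R : ℝ) : Continuous fun x : E ↦ max (R - ‖x‖) 0 := by fun_prop
  have hball : HasDerivAt A (∫ x in ball (0 : E) 2,
      lineDeriv ℝ f x v * (if ‖x‖ < 1 then 1 else 0) ∂μ) 1 := by
    refine (hasDerivAt_integral_of_dominated_loc_of_lip (s := univ) (bound := fun _ ↦ C * ‖v‖)
      Filter.univ_mem (.of_forall fun R ↦ hmeas.mul (hmax R).aestronglyMeasurable) ?_ ?_ ?_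
      (integrable_const _) ?_).2
    · refine Integrable.bdd_mul (c := C * ‖v‖) ?_ hmeas (.of_forall hbound)
      exact ((hmax 1).continuousOn.integrableOn_compact (isCompact_closedBall 0 2)).mono_set
        ball_subset_closedBall
    · exact hmeas.mul (Measurable.ite (measurableSet_lt measurable_norm measurable_const)
        measurable_const measurable_const).aestronglyMeasurable
    · refine .of_forall fun x ↦ (LipschitzWith.of_dist_le_mul fun R S ↦ ?_).lipschitzOnWith
      simp only [dist_eq_norm (_ * _), Pi.mul_apply]
      rw [← mul_sub, norm_mul]
      have h1 : ‖max (R - ‖x‖) 0 - max (S - ‖x‖) 0‖ ≤ dist R S := by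
        refine (abs_max_sub_max_le_abs _ _ _).trans_eq ?_
        rw [sub_sub_sub_cancel_right, Real.dist_eq]
      refine mul_le_mul ?_ h1 (norm_nonneg _) (by positivity)
      simpa using (hbound x).trans (le_abs_self _)
    · filter_upwards [ae_restrict_of_ae (ae_norm_ne μ 1)] with x hx
      exact (hasDerivAt_max_sub_const hx).const_mul _
  rw [← hball.unique hsphere]
  have : ∀ x, lineDeriv ℝ f x v * (if ‖x‖ < 1 then 1 else 0) =
      (ball (0 : E) 1).indicator (fun x ↦ lineDeriv ℝ f x v) x := by
    intro x
    by_cases hx : ‖x‖ < 1 <;> simp [hx]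
  simp only [this]
  rw [setIntegral_indicator measurableSet_ball,
    inter_eq_right.2 (ball_subset_ball one_le_two)]

theorem integral_sphere_comp_neg_mul_inner [Nontrivial E] {f : E → ℝ} {C : NNReal}
    (hf : LipschitzWith C f) (v : E) :
    ∫ w : sphere (0 : E) 1, f (-w) * inner ℝ (w : E) v ∂μ.toSphere =
      -∫ w : sphere (0 : E) 1, f w * inner ℝ (w : E) v ∂μ.toSphere := by
  have hneg : LipschitzWith C fun x ↦ f (-x) := by
    simpa [Function.comp_def] using hf.comp (LipschitzWith.id (α := E)).neg
  have hline (x : E) : lineDeriv ℝ (fun y ↦ f (-y)) x v = -lineDeriv ℝ f (-x) v := by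
    have := deriv_comp_neg (fun t : ℝ ↦ f (-x + t • v)) 0
    simpa [lineDeriv, add_comm] using this
  rw [← integral_ball_lineDeriv_eq_integral_sphere μ hneg v,
    ← integral_ball_lineDeriv_eq_integral_sphere μ hf v, ← integral_neg]
  simp only [hline]
  rw [← integral_indicator measurableSet_ball, ← integral_indicator measurableSet_ball,
    ← integral_neg_eq_self]
  congr 1 with x
  by_cases hx : ‖x‖ < 1 <;> simp [hx]

end BallDivergence

instance (d : ℕ) : IsFiniteMeasure (uniformUnitBall d) := by
  have h : volume (closedBall (0 : EuclideanSpace ℝ (Fin d)) 1) ≠ 0 :=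
    (measure_closedBall_pos _ _ one_pos).ne'
  have : IsFiniteMeasure (volume.restrict (closedBall (0 : EuclideanSpace ℝ (Fin d)) 1)) :=
    isFiniteMeasure_restrict.2 measure_closedBall_lt_top.ne
  exact Measure.smul_finite _ (ENNReal.inv_ne_top.2 h)

theorem closedBall_ae_eq_ball {F : Type*} [NormedAddCommGroup F] [NormedSpace ℝ F]
    [FiniteDimensional ℝ F] [Nontrivial F] [MeasurableSpace F] [BorelSpace F] {μ : Measure F}
    [μ.IsAddHaarMeasure] (x : F) {r : ℝ} : closedBall x r =ᵐ[μ] ball x r := by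
  rw [← ball_union_sphere]
  exact union_ae_eq_left_of_ae_eq_empty (ae_eq_empty.2 (Measure.addHaar_sphere μ x r))

theorem integral_uniformUnitBall {d : ℕ} [Nontrivial (EuclideanSpace ℝ (Fin d))]
    (g : EuclideanSpace ℝ (Fin d) → ℝ) :
    ∫ u, g u ∂uniformUnitBall d =
      (volume.real (ball (0 : EuclideanSpace ℝ (Fin d)) 1))⁻¹ *
        ∫ u in ball (0 : EuclideanSpace ℝ (Fin d)) 1, g u := by
  rw [uniformUnitBall, integral_smul_measure, Measure.addHaar_closedBall_eq_addHaar_ball,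
    setIntegral_congr_set (closedBall_ae_eq_ball 0),
    ENNReal.toReal_inv, smul_eq_mul, measureReal_def]

theorem integral_uniformUnitSphere {d : ℕ}
    (g : sphere (0 : EuclideanSpace ℝ (Fin d)) 1 → ℝ) :
    ∫ w, g w ∂uniformUnitSphere d =
      (d * volume.real (ball (0 : EuclideanSpace ℝ (Fin d)) 1))⁻¹ *
        ∫ w, g w ∂(volume : Measure (EuclideanSpace ℝ (Fin d))).toSphere := by
  rw [uniformUnitSphere, integral_smul_measure, Measure.toSphere_apply_univ,
    ENNReal.toReal_inv, ENNReal.toReal_mul, smul_eq_mul, measureReal_def]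
  simp

theorem ae_uniformUnitBall_of_ae {d : ℕ} {p : EuclideanSpace ℝ (Fin d) → Prop}
    (h : ∀ᵐ u, p u) : ∀ᵐ u ∂uniformUnitBall d, p u :=
  Measure.ae_smul_measure (ae_restrict_of_ae h) _

theorem integrable_uniformUnitBall_of_continuous {d : ℕ}
    {F : Type*} [NormedAddCommGroup F] {g : EuclideanSpace ℝ (Fin d) → F} (hg : Continuous g) :
    Integrable g (uniformUnitBall d) :=
  Integrable.smul_measure (hg.continuousOn.integrableOn_compact (isCompact_closedBall 0 1))
    (ENNReal.inv_ne_top.2 (measure_closedBall_pos _ _ one_pos).ne')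

theorem integrable_uniformUnitSphere_of_continuous {d : ℕ}
    [Nontrivial (EuclideanSpace ℝ (Fin d))] {F : Type*} [NormedAddCommGroup F]
    {g : sphere (0 : EuclideanSpace ℝ (Fin d)) 1 → F} (hg : Continuous g) :
    Integrable g (uniformUnitSphere d) := by
  refine Integrable.smul_measure ?_ (ENNReal.inv_ne_top.2 ?_)
  · exact integrableOn_univ.1 (hg.continuousOn.integrableOn_compact isCompact_univ)
  · exact (Measure.measure_univ_ne_zero).2 (Measure.toSphere_ne_zero _)

/-- The derivative of the smoothing is the average of the derivatives, which exist almost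
everywhere by Rademacher's theorem. -/
theorem hasFDerivAt_randomizedSmoothing_integral_fderiv {d : ℕ}
    {P : EuclideanSpace ℝ (Fin d) → EuclideanSpace ℝ (Fin d)} (hP : LipschitzWith 1 P)
    {δ : ℝ} (hδ : δ ≠ 0) {z : EuclideanSpace ℝ (Fin d)} {C : NNReal}
    (hQ : LipschitzWith C fun u ↦ P (z + δ • u)) :
    Integrable (fun u ↦ δ⁻¹ • fderiv ℝ (fun u ↦ P (z + δ • u)) u) (uniformUnitBall d) ∧
    HasFDerivAt (randomizedSmoothing P δ)
      (∫ u, δ⁻¹ • fderiv ℝ (fun u ↦ P (z + δ • u)) u ∂uniformUnitBall d) z := by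
  refine hasFDerivAt_integral_of_dominated_loc_of_lip (s := Set.univ) (bound := fun _ ↦ 1)
    (F := fun x u ↦ P (x + δ • u)) Filter.univ_mem ?_ ?_ ?_ ?_ (integrable_const _) ?_
  · have := hP.continuous
    exact .of_forall fun x ↦ Continuous.aestronglyMeasurable (by fun_prop)
  · exact integrable_uniformUnitBall_of_continuous hQ.continuous
  · exact ((measurable_fderiv ℝ (fun u ↦ P (z + δ • u))).const_smul δ⁻¹).aestronglyMeasurable
  · refine .of_forall fun u ↦ (LipschitzWith.of_dist_le_mul fun x y ↦ ?_).lipschitzOnWith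
    simpa using hP.dist_le_mul (x + δ • u) (y + δ • u)
  · filter_upwards [ae_uniformUnitBall_of_ae hQ.ae_differentiableAt] with u hu
    have hshift : HasFDerivAt (fun x : EuclideanSpace ℝ (Fin d) ↦ u + δ⁻¹ • (x - z))
        (δ⁻¹ • ContinuousLinearMap.id ℝ _) z :=
      (((hasFDerivAt_id z).sub_const z).const_smul δ⁻¹).const_add u
    have hu' : HasFDerivAt (fun u ↦ P (z + δ • u)) (fderiv ℝ (fun u ↦ P (z + δ • u)) u)
        (u + δ⁻¹ • (z - z)) := by
      simpa using hu.hasFDerivAt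
    have hcomp := hu'.comp z hshift
    convert hcomp using 1
    · ext1 x
      simp only [Function.comp_apply, smul_add, smul_smul, mul_inv_cancel₀ hδ, one_smul]
      congr 1
      abel
    · simp

/-- The randomized smoothing `P_δ` of a `1`-Lipschitz map `P` is
everywhere differentiable, with Jacobian
`DP_δ(z) = (d/(2δ)) · E_w[(P(z + δw) − P(z − δw)) wᵀ]`, `w` uniform on the unit sphere. -/
theorem randomizedSmoothing_hasFDerivAt {d : ℕ}
    (P : EuclideanSpace ℝ (Fin d) → EuclideanSpace ℝ (Fin d))
    (hP : LipschitzWith 1 P) (δ : ℝ) (hδ : 0 < δ) :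
    ∀ z : EuclideanSpace ℝ (Fin d),
      HasFDerivAt (randomizedSmoothing P δ)
        (((d : ℝ) / (2 * δ)) • ∫ w, ((innerSL ℝ (w : EuclideanSpace ℝ (Fin d))).smulRight
          (P (z + δ • (w : EuclideanSpace ℝ (Fin d))) -
            P (z - δ • (w : EuclideanSpace ℝ (Fin d))))) ∂(uniformUnitSphere d)) z := by
  intro z
  rcases Nat.eq_zero_or_pos d with rfl | hd
  · exact hasFDerivAt_of_subsingleton _ z |>.congr_fderiv (Subsingleton.elim _ _)
  have : Nonempty (Fin d) := ⟨⟨0, hd⟩⟩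
  have : Nontrivial (EuclideanSpace ℝ (Fin d)) := inferInstance
  have hPc := hP.continuous
  have hQ : LipschitzWith ‖δ‖₊ fun u ↦ P (z + δ • u) := by
    refine LipschitzWith.of_dist_le_mul fun x y ↦ (hP.dist_le_mul _ _).trans_eq ?_
    simp [dist_smul₀]
  obtain ⟨hint, hderiv⟩ := hasFDerivAt_randomizedSmoothing_integral_fderiv hP hδ.ne' hQ
  refine hderiv.congr_fderiv (ContinuousLinearMap.ext fun v ↦ ext_inner_left ℝ fun e ↦ ?_)
  let L : (EuclideanSpace ℝ (Fin d) →L[ℝ] EuclideanSpace ℝ (Fin d)) →L[ℝ] ℝ :=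
    (innerSL ℝ e).comp (ContinuousLinearMap.apply ℝ _ v)
  let f : EuclideanSpace ℝ (Fin d) → ℝ := fun u ↦ inner ℝ e (P (z + δ • u))
  have hf : LipschitzWith (‖innerSL ℝ e‖₊ * ‖δ‖₊) f := (innerSL ℝ e).lipschitz.comp hQ
  have hfc : Continuous f := hf.continuous
  have hL (A) : inner ℝ e (A v) = L A := rfl
  rw [hL, hL, map_smul, ← L.integral_comp_comm hint, ← L.integral_comp_comm
    (integrable_uniformUnitSphere_of_continuous (by fun_prop)), integral_uniformUnitSphere]
  have hball : ∫ u, L (δ⁻¹ • fderiv ℝ (fun u ↦ P (z + δ • u)) u) ∂uniformUnitBall d =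
      ∫ u, δ⁻¹ * lineDeriv ℝ f u v ∂uniformUnitBall d := by
    refine integral_congr_ae ?_
    filter_upwards [ae_uniformUnitBall_of_ae hQ.ae_differentiableAt] with u hu
    have hfu : HasFDerivAt f ((innerSL ℝ e).comp (fderiv ℝ (fun u ↦ P (z + δ • u)) u)) u :=
      (innerSL ℝ e).hasFDerivAt.comp u hu.hasFDerivAt
    rw [(hfu.hasLineDerivAt v).lineDeriv, map_smul]
    rfl
  have hsphere (w : sphere (0 : EuclideanSpace ℝ (Fin d)) 1) :
      L ((innerSL ℝ (w : EuclideanSpace ℝ (Fin d))).smulRight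
        (P (z + δ • (w : EuclideanSpace ℝ (Fin d))) -
          P (z - δ • (w : EuclideanSpace ℝ (Fin d))))) =
        f w * inner ℝ (w : EuclideanSpace ℝ (Fin d)) v -
          f (-w) * inner ℝ (w : EuclideanSpace ℝ (Fin d)) v := by
    simp only [L, f, ContinuousLinearMap.comp_apply, ContinuousLinearMap.apply_apply,
      ContinuousLinearMap.smulRight_apply, innerSL_apply_apply, inner_smul_right, inner_sub_right,
      smul_neg, ← sub_eq_add_neg]
    ring
  have hintegrable {g : sphere (0 : EuclideanSpace ℝ (Fin d)) 1 → ℝ} (hg : Continuous g) :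
      Integrable g (volume : Measure (EuclideanSpace ℝ (Fin d))).toSphere :=
    integrableOn_univ.1 (hg.continuousOn.integrableOn_compact isCompact_univ)
  simp only [hsphere]
  rw [hball, integral_const_mul, integral_uniformUnitBall,
    integral_ball_lineDeriv_eq_integral_sphere volume hf v,
    integral_sub (hintegrable (by fun_prop)) (hintegrable (by fun_prop)),
    integral_sphere_comp_neg_mul_inner volume hf v, smul_eq_mul]
  have hvol : volume.real (ball (0 : EuclideanSpace ℝ (Fin d)) 1) ≠ 0 :=
    (ENNReal.toReal_pos (measure_ball_pos _ _ one_pos).ne' measure_ball_lt_top.ne).ne'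
  have hd' : (d : ℝ) ≠ 0 := by exact_mod_cast hd.ne'
  have hδ' := hδ.ne'
  field_simp
  ring
end

section
/- Let F : ℝ^d → ℝ be differentiable with L-Lipschitz gradient, let w ∈ ℝ^d, let β > 0 and η > 0 satisfy η·β·L ≤ 1/2. Given x ∈ ℝ^d, set x̃ = x − β·w and x⁺ = x + η·(x̃ − x). Then F(x⁺) ≤ F(x) + η·β·‖∇F(x) − w‖² − (η/(2β))·‖x̃ − x‖². -/
/-- The quadratic upper bound for a function with `L`-Lipschitz gradient. -/
theorem le_add_inner_gradient_add_of_lipschitz_gradient {E : Type*} [NormedAddCommGroup E]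
    [InnerProductSpace ℝ E] [CompleteSpace E] {F : E → ℝ} (hF : Differentiable ℝ F) {L : ℝ}
    (hgrad : ∀ a b : E, ‖gradient F a - gradient F b‖ ≤ L * ‖a - b‖) (x v : E) :
    F (x + v) ≤ F x + inner ℝ (gradient F x) v + L / 2 * ‖v‖ ^ 2 := by
  have hline (t : ℝ) :
      HasDerivAt (fun s : ℝ => F (x + s • v)) (inner ℝ (gradient F (x + t • v)) v) t := by
    have hpath : HasDerivAt (fun s : ℝ => x + s • v) v t := by
      simpa using ((hasDerivAt_id t).smul_const v).const_add x
    simpa [Function.comp_def] using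
      (hF (x + t • v)).hasGradientAt.hasFDerivAt.comp_hasDerivAt t hpath
  have hquad (t : ℝ) :
      HasDerivAt (fun s : ℝ => F x + s * inner ℝ (gradient F x) v + L / 2 * ‖v‖ ^ 2 * s ^ 2)
        (inner ℝ (gradient F x) v + L * t * ‖v‖ ^ 2) t := by
    refine ((((hasDerivAt_id t).mul_const (inner ℝ (gradient F x) v)).const_add (F x)).add
      (((hasDerivAt_id t).pow 2).const_mul (L / 2 * ‖v‖ ^ 2))).congr_deriv ?_
    simp only [id, Nat.cast_ofNat]
    ring
  have hle := image_le_of_deriv_right_le_deriv_boundary (a := 0) (b := 1)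
    (fun t _ => (hline t).continuousAt.continuousWithinAt)
    (fun t _ => (hline t).hasDerivWithinAt) (by simp)
    (fun t _ => (hquad t).continuousAt.continuousWithinAt)
    (fun t _ => (hquad t).hasDerivWithinAt)
    (fun t ht => by
      have hdiff := (real_inner_le_norm (gradient F (x + t • v) - gradient F x) v).trans
        (mul_le_mul_of_nonneg_right (hgrad (x + t • v) x) (norm_nonneg v))
      rw [inner_sub_left, add_sub_cancel_left, norm_smul, Real.norm_of_nonneg ht.1] at hdiff
      linarith)
    (Set.right_mem_Icc.2 zero_le_one)
  simpa using hle

/-- Descent inequality for a momentum-style update with an inexact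
gradient direction `w`: with `x̃ = x − β·w` and `x⁺ = x + η·(x̃ − x)`, if `∇F` is
`L`-Lipschitz and `η·β·L ≤ 1/2`, then
`F(x⁺) ≤ F(x) + η·β·‖∇F(x) − w‖² − (η/(2β))·‖x̃ − x‖²`. -/
theorem descent_inexact_gradient {d : ℕ}
    (F : EuclideanSpace ℝ (Fin d) → ℝ) (hF : Differentiable ℝ F)
    (L : ℝ)
    (hgrad : ∀ a b : EuclideanSpace ℝ (Fin d),
      ‖gradient F a - gradient F b‖ ≤ L * ‖a - b‖)
    (w : EuclideanSpace ℝ (Fin d)) (β η : ℝ) (hβ : 0 < β) (hη : 0 < η)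
    (hstep : η * β * L ≤ 1 / 2) (x : EuclideanSpace ℝ (Fin d)) :
    F (x + η • ((x - β • w) - x)) ≤
      F x + η * β * ‖gradient F x - w‖ ^ 2 - η / (2 * β) * ‖(x - β • w) - x‖ ^ 2 := by
  have hdescent := le_add_inner_gradient_add_of_lipschitz_gradient hF hgrad x (-((η * β) • w))
  have hstep_vec : η • ((x - β • w) - x) = -((η * β) • w) := by
    rw [sub_sub_cancel_left, smul_neg, smul_smul]
  have hs : 0 < η * β := mul_pos hη hβ
  rw [inner_neg_right, inner_smul_right, norm_neg, norm_smul, Real.norm_of_nonneg hs.le]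
    at hdescent
  rw [hstep_vec, sub_sub_cancel_left, norm_neg, norm_smul, Real.norm_of_nonneg hβ.le,
    norm_sub_sq_real]
  have hcoef : η / (2 * β) * (β * ‖w‖) ^ 2 = η * β / 2 * ‖w‖ ^ 2 := by
    field_simp
  rw [hcoef]
  have hsq : 0 ≤ ‖gradient F x - (1 / 2 : ℝ) • w‖ ^ 2 := sq_nonneg _
  rw [norm_sub_sq_real, inner_smul_right, norm_smul,
    Real.norm_of_nonneg (by norm_num : (0 : ℝ) ≤ 1 / 2)] at hsq
  have hcurv : η * β * L * (η * β * ‖w‖ ^ 2) ≤ 1 / 2 * (η * β * ‖w‖ ^ 2) :=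
    mul_le_mul_of_nonneg_right hstep (by positivity)
  linarith [mul_nonneg hs.le hsq]
end

section
/- Let Y ⊆ ℝ^{d₂} be a nonempty closed convex set, μ, L > 0 with μ ≤ L, and let g : ℝ^{d₂} → ℝ be differentiable, μ-strongly convex, with L-Lipschitz gradient, and let y* be the minimizer of g over Y. Let y ∈ Y, v ∈ ℝ^{d₂}, and let s, η satisfy 0 < s ≤ 1/(6L) and 0 < η ≤ 1. Define ỹ = P_Y(y − s·v) and y⁺ = (1 − η)y + η·ỹ. Then ‖y⁺ − y*‖² ≤ (1 − μηs/2)‖y − y*‖² + (4ηs/μ)‖∇g(y) − v‖² − (3η/4)‖ỹ − y‖². -/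
open Set

open AffineMap in
/-- The derivative of `g` along a line, in terms of the gradient. -/
lemma hasDerivAt_comp_lineMap_of_differentiable {E : Type*} [NormedAddCommGroup E]
    [InnerProductSpace ℝ E] [CompleteSpace E] {g : E → ℝ} (hg : Differentiable ℝ g)
    (a b : E) (t : ℝ) :
    HasDerivAt (fun t : ℝ => g (lineMap a b t))
      (inner ℝ (gradient g (lineMap a b t)) (b - a)) t := by
  have h := (hg (lineMap a b t)).hasGradientAt.hasFDerivAt.comp_hasDerivAt t
    (hasDerivAt_lineMap (a := a) (b := b) (x := t))
  simpa [Function.comp_def] using h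

open AffineMap in
/-- The descent lemma: a function with `L`-Lipschitz gradient lies below its quadratic upper
model. -/
lemma le_add_inner_gradient_add_sq {E : Type*} [NormedAddCommGroup E]
    [InnerProductSpace ℝ E] [CompleteSpace E] {g : E → ℝ} {L : ℝ} (hg : Differentiable ℝ g)
    (hgrad : ∀ a b, ‖gradient g a - gradient g b‖ ≤ L * ‖a - b‖) (a b : E) :
    g b ≤ g a + inner ℝ (gradient g a) (b - a) + L / 2 * ‖b - a‖ ^ 2 := by
  have hd (t : ℝ) : HasDerivAt (fun t : ℝ => g (lineMap a b t) -
        (t * inner ℝ (gradient g a) (b - a) + L / 2 * ‖b - a‖ ^ 2 * t ^ 2))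
      (inner ℝ (gradient g (lineMap a b t)) (b - a) -
        (1 * inner ℝ (gradient g a) (b - a) + L / 2 * ‖b - a‖ ^ 2 * (2 * t))) t := by
    have h2 : HasDerivAt (fun t : ℝ => t ^ 2) (2 * t) t := by simpa using hasDerivAt_pow 2 t
    exact (hasDerivAt_comp_lineMap_of_differentiable hg a b t).sub
      (((hasDerivAt_id t).mul_const _).add (h2.const_mul _))
  have hanti := antitoneOn_of_hasDerivWithinAt_nonpos (convex_Icc (0 : ℝ) 1)
    (fun t _ => (hd t).continuousAt.continuousWithinAt)
    (fun t _ => (hd t).hasDerivWithinAt) fun t ht => by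
      rw [interior_Icc] at ht
      have h1 := real_inner_le_norm (gradient g (lineMap a b t) - gradient g a) (b - a)
      have h2 := hgrad (lineMap a b t) a
      have h3 : lineMap a b t - a = t • (b - a) := by simp [lineMap_apply]
      rw [h3, norm_smul, Real.norm_of_nonneg ht.1.le] at h2
      rw [inner_sub_left] at h1
      nlinarith [mul_le_mul_of_nonneg_right h2 (norm_nonneg (b - a))]
  have h := hanti (left_mem_Icc.2 zero_le_one) (right_mem_Icc.2 zero_le_one) zero_le_one
  simp only [lineMap_apply_zero, lineMap_apply_one, zero_mul, one_mul, one_pow, mul_one] at h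
  linarith

open AffineMap in
/-- A differentiable strongly convex function lies above its quadratic lower model. -/
lemma add_inner_gradient_add_sq_le {E : Type*} [NormedAddCommGroup E]
    [InnerProductSpace ℝ E] [CompleteSpace E] {g : E → ℝ} {μ : ℝ} (hg : Differentiable ℝ g)
    (hsc : ConvexOn ℝ univ (fun y => g y - μ / 2 * ‖y‖ ^ 2)) (a b : E) :
    g a + inner ℝ (gradient g a) (b - a) + μ / 2 * ‖b - a‖ ^ 2 ≤ g b := by
  have hl : HasDerivAt (fun t : ℝ => (lineMap a b t : E)) (b - a) 0 := hasDerivAt_lineMap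
  have hd := (hasDerivAt_comp_lineMap_of_differentiable hg a b 0).sub (hl.norm_sq.const_mul (μ / 2))
  have hc : ConvexOn ℝ univ (fun t : ℝ => g (lineMap a b t) - μ / 2 * ‖lineMap a b t‖ ^ 2) :=
    hsc.comp_affineMap (lineMap a b)
  have h := hc.le_slope_of_hasDerivAt (mem_univ 0) (mem_univ 1) zero_lt_one hd
  simp only [slope_def_field, lineMap_apply_zero, lineMap_apply_one, sub_zero, div_one] at h
  rw [inner_sub_right a, real_inner_self_eq_norm_sq] at h
  rw [norm_sub_sq_real, real_inner_comm a b]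
  linarith

/-- The variational inequality for a nearest point of a convex set. -/
lemma Convex.inner_sub_sub_nonpos_of_forall_norm_sub_le {E : Type*} [NormedAddCommGroup E]
    [InnerProductSpace ℝ E] {Y : Set E} (hY : Convex ℝ Y) {u p : E} (hp : p ∈ Y)
    (hmin : ∀ w ∈ Y, ‖u - p‖ ≤ ‖u - w‖) {w : E} (hw : w ∈ Y) :
    inner ℝ (u - p) (w - p) ≤ 0 := by
  have : Nonempty Y := ⟨⟨p, hp⟩⟩
  refine (norm_eq_iInf_iff_real_inner_le_zero hY hp).1 (le_antisymm ?_ ?_) w hw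
  · exact le_ciInf fun w => hmin w w.2
  · exact ciInf_le ⟨0, by rintro _ ⟨w, rfl⟩; exact norm_nonneg _⟩ (⟨p, hp⟩ : Y)

/-- Young's inequality for the inner product. -/
lemma neg_two_mul_inner_le {E : Type*} [NormedAddCommGroup E] [InnerProductSpace ℝ E]
    {c : ℝ} (hc : 0 < c) (x y : E) :
    -(2 * inner ℝ x y) ≤ ‖x‖ ^ 2 / c + c * ‖y‖ ^ 2 := by
  have h := norm_add_sq_real x (c • y)
  rw [inner_smul_right, norm_smul, Real.norm_of_nonneg hc.le] at h
  have h' : 0 ≤ ‖x + c • y‖ ^ 2 / c := by positivity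
  rw [h] at h'
  have e : (‖x‖ ^ 2 + 2 * (c * inner ℝ x y) + (c * ‖y‖) ^ 2) / c =
      ‖x‖ ^ 2 / c + 2 * inner ℝ x y + c * ‖y‖ ^ 2 := by
    field_simp
  linarith

open Set

/-- One-step contraction of the inexact projected gradient update with
averaging: with `ỹ = P_Y(y − s·v)` and `y⁺ = (1 − η)y + η·ỹ`,
`‖y⁺ − y*‖² ≤ (1 − μηs/2)‖y − y*‖² + (4ηs/μ)‖∇g(y) − v‖² − (3η/4)‖ỹ − y‖²`. -/
theorem projected_gradient_contraction {d₂ : ℕ}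
    (Y : Set (EuclideanSpace ℝ (Fin d₂))) (hYne : Y.Nonempty) (hYclosed : IsClosed Y)
    (hYconv : Convex ℝ Y)
    (μ L : ℝ) (hμ : 0 < μ) (hL : 0 < L) (hμL : μ ≤ L)
    (g : EuclideanSpace ℝ (Fin d₂) → ℝ) (hg : Differentiable ℝ g)
    (hsc : ConvexOn ℝ univ (fun y => g y - μ / 2 * ‖y‖ ^ 2))
    (hgrad : ∀ a b, ‖gradient g a - gradient g b‖ ≤ L * ‖a - b‖)
    (ystar : EuclideanSpace ℝ (Fin d₂))
    (hystar : ystar ∈ Y ∧ ∀ y' ∈ Y, g ystar ≤ g y')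
    (y : EuclideanSpace ℝ (Fin d₂)) (hy : y ∈ Y)
    (v : EuclideanSpace ℝ (Fin d₂)) (s η : ℝ)
    (hs : 0 < s) (hs' : s ≤ 1 / (6 * L)) (hη : 0 < η) (hη' : η ≤ 1)
    (ytil : EuclideanSpace ℝ (Fin d₂))
    (hytil : ytil ∈ Y ∧ ∀ y' ∈ Y, ‖(y - s • v) - ytil‖ ≤ ‖(y - s • v) - y'‖) :
    ‖((1 - η) • y + η • ytil) - ystar‖ ^ 2 ≤
      (1 - μ * η * s / 2) * ‖y - ystar‖ ^ 2 +
        (4 * η * s / μ) * ‖gradient g y - v‖ ^ 2 - (3 * η / 4) * ‖ytil - y‖ ^ 2 := by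
  have hproj := hYconv.inner_sub_sub_nonpos_of_forall_norm_sub_le hytil.1 hytil.2 hystar.1
  have hdesc := le_add_inner_gradient_add_sq hg hgrad y ytil
  have hstrong := add_inner_gradient_add_sq_le hg hsc y ystar
  have hmin := hystar.2 ytil hytil.1
  have hμ2 : 0 < μ / 2 := by positivity
  have hyoung₁ := neg_two_mul_inner_le hμ2 (gradient g y - v) (ystar - y)
  have hyoung₂ := neg_two_mul_inner_le hμ2 (gradient g y - v) (y - ytil)
  have hsL : s * L ≤ 1 / 6 := by
    rw [le_div_iff₀ (by positivity)] at hs'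
    linarith
  have hsμ : s * μ ≤ 1 / 6 := (mul_le_mul_of_nonneg_left hμL hs.le).trans hsL
  have hE : ‖gradient g y - v‖ ^ 2 / (μ / 2) = 2 / μ * ‖gradient g y - v‖ ^ 2 := by
    field_simp
  rw [hE, norm_sub_rev ystar y] at hyoung₁
  rw [hE, norm_sub_rev y ytil] at hyoung₂
  rw [norm_sub_rev ystar y] at hstrong
  have hsplit : inner ℝ v (ystar - ytil) =
      inner ℝ (gradient g y) (ystar - y) - inner ℝ (gradient g y) (ytil - y) -
        inner ℝ (gradient g y - v) (ystar - y) - inner ℝ (gradient g y - v) (y - ytil) := by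
    simp only [inner_sub_left, inner_sub_right]
    ring
  have hv : 2 * inner ℝ v (ystar - ytil) ≤ -(μ / 2) * ‖y - ystar‖ ^ 2 +
      4 / μ * ‖gradient g y - v‖ ^ 2 + (L + μ / 2) * ‖ytil - y‖ ^ 2 := by
    have h4 : 4 / μ = 2 / μ + 2 / μ := by ring
    rw [h4, hsplit]
    linarith
  have hstep : 2 * (s * inner ℝ v (ystar - ytil)) ≤ -(s * μ / 2) * ‖y - ystar‖ ^ 2 +
      4 * s / μ * ‖gradient g y - v‖ ^ 2 + 1 / 4 * ‖ytil - y‖ ^ 2 := by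
    have hP : (s * L + s * μ / 2) * ‖ytil - y‖ ^ 2 ≤ 1 / 4 * ‖ytil - y‖ ^ 2 :=
      mul_le_mul_of_nonneg_right (by linarith) (sq_nonneg _)
    have h := mul_le_mul_of_nonneg_left hv hs.le
    have h4 : 4 * s / μ = s * (4 / μ) := by ring
    rw [h4]
    linarith
  have hvar : ‖y - ystar‖ ^ 2 = ‖ytil - y‖ ^ 2 + ‖ytil - ystar‖ ^ 2 -
      2 * inner ℝ (y - ytil) (ystar - ytil) := by
    have h := norm_sub_sq_real (y - ytil) (ystar - ytil)
    rw [sub_sub_sub_cancel_right, norm_sub_rev y ytil, norm_sub_rev ystar ytil] at h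
    linarith
  have hproj' : inner ℝ (y - ytil) (ystar - ytil) ≤ s * inner ℝ v (ystar - ytil) := by
    rw [sub_right_comm, inner_sub_left, real_inner_smul_left] at hproj
    linarith
  have havg : ‖((1 - η) • y + η • ytil) - ystar‖ ^ 2 =
      (1 - η) * ‖y - ystar‖ ^ 2 + η * ‖ytil - ystar‖ ^ 2 - η * (1 - η) * ‖ytil - y‖ ^ 2 := by
    have h₁ : ((1 - η) • y + η • ytil) - ystar = (y - ystar) + η • (ytil - y) := by module
    have h₂ : ytil - ystar = (y - ystar) + (ytil - y) := by abel
    rw [h₁, h₂, norm_add_sq_real, norm_add_sq_real, inner_smul_right, norm_smul,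
      Real.norm_of_nonneg hη.le]
    ring
  have htil : ‖ytil - ystar‖ ^ 2 ≤ (1 - s * μ / 2) * ‖y - ystar‖ ^ 2 +
      4 * s / μ * ‖gradient g y - v‖ ^ 2 - 3 / 4 * ‖ytil - y‖ ^ 2 := by
    linarith
  have hη0 : 0 ≤ η * (1 - η) * ‖ytil - y‖ ^ 2 :=
    mul_nonneg (mul_nonneg hη.le (sub_nonneg.2 hη')) (sq_nonneg _)
  have h := mul_le_mul_of_nonneg_left htil hη.le
  have h4 : 4 * η * s / μ = η * (4 * s / μ) := by ring
  rw [havg, h4]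
  linarith
end
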